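/- Let S ⊆ ℝ^m and V ⊆ ℝ^n, where V is nonempty, connected, and open as a subset of ℝ^n; equip S × V with the subspace topology of ℝ^m × ℝ^n. Let Φ : S × V → S × V be a homeomorphism of the form Φ(s,v) = (φ(s), ψ(s,v)) for some maps φ : S → S and ψ : S × V → V. Then: φ is a homeomorphism of S onto S; for every s ∈ S the map ψ_s : v ↦ ψ(s,v) is a homeomorphism of V onto V; and Φ⁻¹(s',v') = (φ⁻¹(s'), ψ_{φ⁻¹(s')}⁻¹(v')) for all (s',v') ∈ S × V. -/

import Mathlib

section Helpers

open Set MeasureTheory Metric Topology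
open scoped NNReal

lemma small_change {N : ℕ} (g : (Fin (N+1) → ℝ) → (Fin (N+1) → ℝ)) (hg : ContDiff ℝ 1 g) (R : ℝ)
    (hs : ∀ x, x ∉ closedBall (0 : Fin (N+1) → ℝ) R → g x = 0) :
    ∃ t0 : ℝ, 0 < t0 ∧ ∀ t ∈ Ioo 0 t0, ∀ p : (Fin (N+1) → ℝ) → ℝ,
      ∫ x in closedBall (0 : Fin (N+1) → ℝ) R,
        (ContinuousLinearMap.id ℝ _ + t • fderiv ℝ g x).det * p (x + t • g x)
        = ∫ x in closedBall (0 : Fin (N+1) → ℝ) R, p x := by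
  have hcs : HasCompactSupport g := HasCompactSupport.intro (isCompact_closedBall 0 R) hs
  obtain ⟨K, hK⟩ := ContDiff.lipschitzWith_of_hasCompactSupport hcs hg one_ne_zero
  obtain ⟨C, hC⟩ := (hcs.fderiv ℝ).exists_bound_of_continuous (hg.continuous_fderiv one_ne_zero)
  have hdet : ∀ᶠ A : (Fin (N+1) → ℝ) →L[ℝ] (Fin (N+1) → ℝ) in 𝓝 0,
      0 < (ContinuousLinearMap.id ℝ _ + A).det := by
    have hc : Continuous fun A : (Fin (N+1) → ℝ) →L[ℝ] (Fin (N+1) → ℝ) =>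
        (ContinuousLinearMap.id ℝ _ + A).det :=
      ContinuousLinearMap.continuous_det.comp (continuous_const.add continuous_id)
    refine hc.continuousAt.eventually_const_lt ?_
    simp [ContinuousLinearMap.det]
  obtain ⟨e, he, hdet⟩ := Metric.eventually_nhds_iff.1 hdet
  have hC0 : 0 ≤ C := (norm_nonneg _).trans (hC 0)
  refine ⟨min (e / (C + 1)) (1 / (K + 1)), by positivity, ?_⟩
  rintro t ⟨ht0, ht⟩ p
  have ht1 : t * (C + 1) < e := by
    rw [← lt_div_iff₀ (by positivity)]; exact ht.trans_le (min_le_left _ _)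
  have ht2 : t * (K + 1) < 1 := by
    rw [← lt_div_iff₀ (by positivity)]; exact ht.trans_le (min_le_right _ _)
  have hpos : ∀ x, 0 < (ContinuousLinearMap.id ℝ _ + t • fderiv ℝ g x).det := by
    intro x
    apply hdet
    rw [dist_zero_right, norm_smul, Real.norm_of_nonneg ht0.le]
    nlinarith [hC x]
  set f : (Fin (N+1) → ℝ) → (Fin (N+1) → ℝ) := fun x => x + t • g x with hf
  have happ : ApproximatesLinearOn f
      ((ContinuousLinearEquiv.refl ℝ (Fin (N+1) → ℝ) : (Fin (N+1) → ℝ) ≃L[ℝ] _) :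
        (Fin (N+1) → ℝ) →L[ℝ] (Fin (N+1) → ℝ)) univ (Real.toNNReal t * K) := by
    intro x _ y _
    have : f x - f y - (x - y) = t • (g x - g y) := by
      simp only [hf]; rw [smul_sub]; abel
    simp only [ContinuousLinearEquiv.coe_refl, ContinuousLinearMap.id_apply]
    rw [this, norm_smul, Real.norm_of_nonneg ht0.le]
    have := hK.dist_le_mul x y
    rw [dist_eq_norm, dist_eq_norm] at this
    rw [NNReal.coe_mul, Real.coe_toNNReal _ ht0.le, mul_assoc]
    exact mul_le_mul_of_nonneg_left this ht0.le
  have hc : (Real.toNNReal t * K : ℝ≥0) < 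
      ‖((ContinuousLinearEquiv.refl ℝ (Fin (N+1) → ℝ)).symm :
        (Fin (N+1) → ℝ) →L[ℝ] (Fin (N+1) → ℝ))‖₊⁻¹ := by
    have : ‖((ContinuousLinearEquiv.refl ℝ (Fin (N+1) → ℝ)).symm :
        (Fin (N+1) → ℝ) →L[ℝ] (Fin (N+1) → ℝ))‖₊ = 1 := by
      rw [← NNReal.coe_inj]
      simp
    rw [this, inv_one, ← NNReal.coe_lt_coe]
    rw [NNReal.coe_mul, Real.coe_toNNReal _ ht0.le, NNReal.coe_one]
    nlinarith
  have hsurj := happ.surjective (Or.inr hc)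
  have hinj := injOn_univ.1 (happ.injOn (Or.inr hc))
  have hout : ∀ x, x ∉ closedBall (0 : Fin (N+1) → ℝ) R → f x = x := by
    intro x hx; simp [hf, hs x hx]
  have himg : f '' closedBall 0 R = closedBall 0 R := by
    ext y
    constructor
    · rintro ⟨x, hx, rfl⟩
      by_contra hy
      have := hinj (hout _ hy)
      rw [this] at hy
      exact hy hx
    · intro hy
      obtain ⟨x, rfl⟩ := hsurj y
      refine ⟨x, ?_, rfl⟩
      by_contra hx
      rw [hout x hx] at hy
      exact hx hy
  have hder : ∀ x ∈ closedBall (0 : Fin (N+1) → ℝ) R, HasFDerivWithinAt f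
      (ContinuousLinearMap.id ℝ _ + t • fderiv ℝ g x) (closedBall 0 R) x := by
    intro x _
    exact ((hasFDerivAt_id x).add
      (((hg.differentiable one_ne_zero) x).hasFDerivAt.const_smul t)).hasFDerivWithinAt
  have key := integral_image_eq_integral_abs_det_fderiv_smul (volume : Measure (Fin (N+1) → ℝ))
    measurableSet_closedBall hder hinj.injOn p
  rw [himg] at key
  rw [key]
  refine integral_congr_ae (Filter.Eventually.of_forall fun x => ?_)
  simp [abs_of_pos (hpos x), hf]

lemma poly_integral {E : Type*} [TopologicalSpace E] [MeasurableSpace E] [OpensMeasurableSpace E]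
    [T2Space E]
    (μ : Measure E) [IsFiniteMeasureOnCompacts μ] (B : Set E) (hB : IsCompact B)
    (Q : Polynomial C(E, ℝ)) :
    ∃ q : Polynomial ℝ, ∀ t, q.eval t =
      ∫ x in B, Polynomial.eval₂ (ContinuousMap.evalAlgHom ℝ ℝ x : C(E, ℝ) →+* ℝ) t Q ∂μ := by
  refine ⟨∑ i ∈ Finset.range (Q.natDegree + 1),
    Polynomial.C (∫ x in B, Q.coeff i x ∂μ) * Polynomial.X ^ i, fun t => ?_⟩
  simp only [Polynomial.eval₂_eq_sum_range]
  rw [integral_finsetSum]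
  · simp [Polynomial.eval_finsetSum, integral_mul_const]
  · intro i _
    apply ContinuousOn.integrableOn_compact' hB hB.measurableSet
    apply Continuous.continuousOn
    exact ((Q.coeff i).continuous).mul continuous_const

lemma full_change {N : ℕ} (g : (Fin (N+1) → ℝ) → (Fin (N+1) → ℝ)) (hg : ContDiff ℝ 1 g) (R : ℝ)
    (hs : ∀ x, x ∉ closedBall (0 : Fin (N+1) → ℝ) R → g x = 0) (M : ℝ) (k : ℕ) :
      ∫ x in closedBall (0 : Fin (N+1) → ℝ) R,
        (ContinuousLinearMap.id ℝ _ + fderiv ℝ g x).det * (M - ∑ i, ((x + g x) i)^2) ^ k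
        = ∫ x in closedBall (0 : Fin (N+1) → ℝ) R, (M - ∑ i, (x i)^2) ^ k := by
  obtain ⟨t0, ht0, hsm⟩ := small_change g hg R hs
  have hgc := hg.continuous
  have hdc := hg.continuous_fderiv one_ne_zero
  let X : Fin (N+1) → C(Fin (N+1) → ℝ, ℝ) := fun i => ⟨fun x => x i, by fun_prop⟩
  let G : Fin (N+1) → C(Fin (N+1) → ℝ, ℝ) := fun i => ⟨fun x => g x i, by fun_prop⟩
  let D : Fin (N+1) → Fin (N+1) → C(Fin (N+1) → ℝ, ℝ) := fun i j =>
    ⟨fun x => fderiv ℝ g x (Pi.single j 1) i, by fun_prop⟩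
  let Mat : Matrix (Fin (N+1)) (Fin (N+1)) (Polynomial C(Fin (N+1) → ℝ, ℝ)) :=
    Matrix.of fun i j => (if i = j then 1 else 0) + Polynomial.X * Polynomial.C (D i j)
  let Q : Polynomial C(Fin (N+1) → ℝ, ℝ) := Mat.det *
    (Polynomial.C (ContinuousMap.const _ M)
      - ∑ i, (Polynomial.C (X i) + Polynomial.X * Polynomial.C (G i)) ^ 2) ^ k
  have hQ : ∀ t x, Polynomial.eval₂ (ContinuousMap.evalAlgHom ℝ ℝ x :
        C(Fin (N+1) → ℝ, ℝ) →+* ℝ) t Q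
      = (ContinuousLinearMap.id ℝ _ + t • fderiv ℝ g x).det
        * (M - ∑ i, ((x + t • g x) i)^2) ^ k := by
    intro t x
    rw [← Polynomial.coe_eval₂RingHom]
    simp only [Q, map_mul, map_pow, map_sub, map_sum, map_add, RingHom.map_det]
    congr 1
    · rw [ContinuousLinearMap.det, ← LinearMap.det_toMatrix']
      congr 1
      ext i j
      simp only [Mat, RingHom.mapMatrix_apply, Matrix.map_apply, Matrix.of_apply, map_add, map_mul,
        LinearMap.toMatrix'_apply]
      by_cases hij : i = j
      · subst hij
        simp [D]
      · simp [D, hij]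
    · simp [X, G]
  obtain ⟨q, hq⟩ := poly_integral (volume : Measure (Fin (N+1) → ℝ)) (closedBall 0 R)
    (isCompact_closedBall 0 R) Q
  have hqc : q = Polynomial.C (∫ x in closedBall (0 : Fin (N+1) → ℝ) R, (M - ∑ i, (x i)^2) ^ k) := by
    apply Polynomial.eq_of_infinite_eval_eq
    apply (Ioo_infinite ht0).mono
    intro t ht
    simp only [mem_ofPred_eq, Polynomial.eval_C]
    rw [hq, ← hsm t ht (fun y => (M - ∑ i, (y i)^2) ^ k)]
    simp only [hQ]
  have h1 := hq 1
  rw [hqc] at h1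
  simp only [hQ, Polynomial.eval_C, one_smul] at h1
  exact h1.symm

lemma no_small_zero {N : ℕ} (g : (Fin (N+1) → ℝ) → (Fin (N+1) → ℝ)) (hg : ContDiff ℝ 1 g) (R : ℝ)
    (hR : 0 < R)
    (hs : ∀ x, x ∉ closedBall (0 : Fin (N+1) → ℝ) R → g x = 0) (δ : ℝ) (hδ : 0 < δ)
    (h : ∀ x, (ContinuousLinearMap.id ℝ _ + fderiv ℝ g x).det = 0 ∨ δ ≤ ‖x + g x‖) : False := by
  have hgc := hg.continuous
  have hdc := hg.continuous_fderiv one_ne_zero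
  have hB := isCompact_closedBall (0 : Fin (N+1) → ℝ) R
  obtain ⟨M1, hM1⟩ := hB.exists_bound_of_continuousOn
    (f := fun x => ∑ i, ((x + g x) i)^2) (by fun_prop)
  obtain ⟨M2, hM2⟩ := hB.exists_bound_of_continuousOn
    (f := fun x : Fin (N+1) → ℝ => ∑ i, (x i)^2) (by fun_prop)
  obtain ⟨C, hC⟩ := hB.exists_bound_of_continuousOn
    (f := fun x => (ContinuousLinearMap.id ℝ _ + fderiv ℝ g x).det)
    (ContinuousLinearMap.continuous_det.comp (continuous_const.add hdc)).continuousOn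
  have hC0 : 0 ≤ C := (norm_nonneg _).trans (hC 0 (mem_closedBall_self hR.le))
  set M := max (max M1 M2) (δ^2) with hM
  have hMM1 : M1 ≤ M := (le_max_left _ _).trans (le_max_left _ _)
  have hMM2 : M2 ≤ M := (le_max_right _ _).trans (le_max_left _ _)
  have hMδ : δ^2 ≤ M := le_max_right _ _
  have hev : ∀ᶠ x : Fin (N+1) → ℝ in 𝓝 0, ∑ i, (x i)^2 < δ^2/2 := by
    have hc : Continuous fun x : Fin (N+1) → ℝ => ∑ i, (x i)^2 := by fun_prop
    refine hc.continuousAt.eventually_lt_const ?_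
    simp; positivity
  obtain ⟨r, hr, hball⟩ := Metric.mem_nhds_iff.1 (Filter.inter_mem hev (closedBall_mem_nhds 0 hR))
  set v := (volume : Measure (Fin (N+1) → ℝ)).real (ball 0 r) with hv
  have hv0 : 0 < v := ENNReal.toReal_pos (measure_ball_pos _ _ hr).ne' measure_ball_lt_top.ne
  set V := (volume : Measure (Fin (N+1) → ℝ)).real (closedBall 0 R) with hV
  have hδ2 : 0 < δ^2 := by positivity
  have key : ∀ k : ℕ, v * (M - δ^2/2)^k ≤ C * (M - δ^2)^k * V := by
    intro k
    have e := full_change g hg R hs M k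
    have up : ‖∫ x in closedBall (0 : Fin (N+1) → ℝ) R,
        (ContinuousLinearMap.id ℝ _ + fderiv ℝ g x).det * (M - ∑ i, ((x + g x) i)^2) ^ k‖
        ≤ C * (M - δ^2)^k * V := by
      apply norm_setIntegral_le_of_norm_le_const measure_closedBall_lt_top
      intro x hx
      rcases h x with h0 | h1
      · rw [h0, zero_mul, norm_zero]
        exact mul_nonneg hC0 (pow_nonneg (by linarith) _)
      · rw [norm_mul, norm_pow]
        have a1 := hM1 x hx
        have a2 : δ^2 ≤ ∑ i, ((x + g x) i)^2 := by
          obtain ⟨i, hi⟩ : ∃ i, δ ≤ ‖(x + g x) i‖ := by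
            by_contra! hcon
            exact absurd ((pi_norm_lt_iff hδ).2 hcon) (not_lt.2 h1)
          calc δ^2 ≤ ‖(x + g x) i‖^2 := by gcongr
            _ = ((x + g x) i)^2 := by simp
            _ ≤ _ := Finset.single_le_sum (f := fun i => ((x + g x) i)^2)
                  (fun j _ => sq_nonneg _) (Finset.mem_univ i)
        have a3 : ‖M - ∑ i, ((x + g x) i)^2‖ ≤ M - δ^2 := by
          have := (le_abs_self _).trans a1
          rw [Real.norm_of_nonneg (by linarith)]
          linarith
        exact mul_le_mul (hC x hx) (pow_le_pow_left₀ (norm_nonneg _) a3 _) (by positivity) hC0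
    have lo : v * (M - δ^2/2)^k ≤ ∫ x in closedBall (0 : Fin (N+1) → ℝ) R,
        (M - ∑ i, (x i)^2) ^ k := by
      have hcont : Continuous fun x : Fin (N+1) → ℝ => (M - ∑ i, (x i)^2) ^ k := by fun_prop
      calc v * (M - δ^2/2)^k = ∫ x in ball (0 : Fin (N+1) → ℝ) r, (M - δ^2/2)^k := by
            simp [hv]
        _ ≤ ∫ x in ball (0 : Fin (N+1) → ℝ) r, (M - ∑ i, (x i)^2) ^ k := by
            apply setIntegral_mono_on
            · exact integrableOn_const measure_ball_lt_top.ne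
            · exact (hcont.continuousOn.integrableOn_compact hB).mono_set
                (fun x hx => (hball hx).2)
            · exact measurableSet_ball
            · intro x hx
              have h1 : ∑ i, (x i)^2 < δ^2/2 := (hball hx).1
              apply pow_le_pow_left₀ <;> linarith
        _ ≤ _ := by
            apply setIntegral_mono_set (hcont.continuousOn.integrableOn_compact hB)
            · filter_upwards [ae_restrict_mem measurableSet_closedBall] with x hx
              have := (le_abs_self _).trans (hM2 x hx)
              exact pow_nonneg (by linarith) _
            · exact Filter.Eventually.of_forall (fun x hx => (hball hx).2)
    rw [← e] at lo
    exact lo.trans ((le_abs_self _).trans up)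
  have hb : 0 < M - δ^2/2 := by linarith
  have hq0 : 0 ≤ (M - δ^2) / (M - δ^2/2) := div_nonneg (by linarith) hb.le
  have hq1 : (M - δ^2) / (M - δ^2/2) < 1 := by rw [div_lt_one hb]; linarith
  have hlim := (tendsto_pow_atTop_nhds_zero_of_lt_one hq0 hq1).const_mul (C * V)
  rw [mul_zero] at hlim
  have := ge_of_tendsto' (b := v) hlim (fun k => by
    rw [div_pow, mul_div_assoc', le_div_iff₀ (pow_pos hb k)]
    linarith [key k])
  linarith

lemma no_cube_factor {N : ℕ} {F : Type*} [NormedAddCommGroup F] [NormedSpace ℝ F]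
    [FiniteDimensional ℝ F] (hF : Module.finrank ℝ F < N + 1)
    (h : (Fin (N+1) → ℝ) → F) (hh : Continuous h) (K : Set F) (hK : IsCompact K)
    (hhK : ∀ x, h x ∈ K) (G : F → (Fin (N+1) → ℝ)) (hG : Continuous G)
    (h1 : ∀ x i, 1 ≤ x i → 1 ≤ G (h x) i) (h2 : ∀ x i, x i ≤ -1 → G (h x) i ≤ -1) : False := by
  obtain ⟨P, hP, hPG, -⟩ := hG.exists_contDiff_approx 1 (ε := fun _ => 1/4) continuous_const
    (by norm_num)
  have hU := hK.uniformContinuousAt_of_continuousAt P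
    (fun x _ => hP.continuous.continuousAt) (dist_mem_uniformity (show (0:ℝ) < 1/4 by norm_num))
  obtain ⟨e, he, hU⟩ := Metric.mem_uniformity_dist.1 hU
  obtain ⟨H, hH, hHh, -⟩ := hh.exists_contDiff_approx 1 (ε := fun _ => e) continuous_const
    (fun _ => he)
  have hclose : ∀ x i, |P (H x) i - G (h x) i| ≤ 1/2 := by
    intro x i
    have a1 : dist (P (h x)) (P (H x)) < 1/4 := hU (by rw [dist_comm]; exact hHh x) (hhK x)
    have a2 := hPG (h x)
    have a3 : dist (P (H x)) (G (h x)) ≤ 1/2 := by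
      have := dist_triangle_left (P (H x)) (G (h x)) (P (h x))
      linarith
    have a4 := (dist_le_pi_dist (P (H x)) (G (h x)) i).trans a3
    rwa [Real.dist_eq] at a4
  let χ : ContDiffBump (0 : Fin (N+1) → ℝ) := ⟨1, 2, by norm_num, by norm_num⟩
  have hf : ContDiff ℝ 1 (fun x => P (H x)) := hP.comp hH
  refine no_small_zero (fun x => χ x • (P (H x) - x)) ?_ 2 (by norm_num) ?_ (1/2) (by norm_num) ?_
  · exact χ.contDiff.smul (hf.sub contDiff_id)
  · intro x hx
    rw [χ.zero_of_le_dist, zero_smul]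
    rw [mem_closedBall, not_le] at hx
    exact hx.le
  · intro x
    by_cases hx : ‖x‖ < 1
    · left
      have heq : (fun x => χ x • (P (H x) - x)) =ᶠ[𝓝 x] fun x => P (H x) - x := by
        filter_upwards [isOpen_ball.mem_nhds (show x ∈ ball (0 : Fin (N+1) → ℝ) 1 by simpa using hx)]
          with y hy
        rw [χ.one_of_mem_closedBall (ball_subset_closedBall hy), one_smul]
      have hPd := (hP.differentiable one_ne_zero) (H x)
      have hHd := (hH.differentiable one_ne_zero) x
      have hd : HasFDerivAt (fun x => P (H x) - x)
          ((fderiv ℝ P (H x)).comp (fderiv ℝ H x) - ContinuousLinearMap.id ℝ _) x :=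
        (hPd.hasFDerivAt.comp x hHd.hasFDerivAt).sub (hasFDerivAt_id x)
      rw [heq.fderiv_eq, hd.fderiv, add_sub_cancel]
      rw [ContinuousLinearMap.det]
      by_contra hne
      have hinj : Function.Injective (fderiv ℝ H x) := by
        intro a b hab
        apply (LinearEquiv.ofIsUnitDet (f := ((fderiv ℝ P (H x)).comp (fderiv ℝ H x) :
            (Fin (N+1) → ℝ) →ₗ[ℝ] (Fin (N+1) → ℝ)))
            (v := Pi.basisFun ℝ _) (v' := Pi.basisFun ℝ _)
            (by rw [LinearMap.det_toMatrix]; exact isUnit_iff_ne_zero.2 hne)).injective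
        simp [hab]
      have := LinearMap.finrank_le_finrank_of_injective (f := (fderiv ℝ H x).toLinearMap) hinj
      simp at this
      omega
    · right
      obtain ⟨i, hi⟩ : ∃ i, 1 ≤ ‖x i‖ := by
        by_contra! hcon
        exact hx ((pi_norm_lt_iff one_pos).2 hcon)
      refine le_trans ?_ (norm_le_pi_norm _ i)
      have b0 : 0 ≤ χ x := χ.nonneg
      have b1 : χ x ≤ 1 := χ.le_one
      have b2 := abs_le.1 (hclose x i)
      simp only [Pi.add_apply, Pi.smul_apply, Pi.sub_apply, smul_eq_mul]
      rw [Real.norm_eq_abs] at hi ⊢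
      rcases le_abs.1 hi with hi | hi
      · have := h1 x i hi
        refine le_trans ?_ (le_abs_self _)
        nlinarith
      · have := h2 x i (by linarith)
        refine le_trans ?_ (neg_le_abs _)
        nlinarith

lemma triangular_base_injective
    {m n : ℕ} (S : Set (EuclideanSpace ℝ (Fin m))) (V : Set (EuclideanSpace ℝ (Fin n)))
    {v0 : EuclideanSpace ℝ (Fin n)} (hv0 : v0 ∈ V) (hVconn : IsConnected V) (hVopen : IsOpen V)
    (Φ : (↥S × ↥V) ≃ₜ (↥S × ↥V))
    (φ : ↥S → ↥S) (ψ : ↥S × ↥V → ↥V)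
    (hΦ : ∀ p : ↥S × ↥V, Φ p = (φ p.1, ψ p)) : Function.Injective φ := by
  have hψ : Continuous ψ := by
    have : ψ = fun p => (Φ p).2 := by ext1 p; rw [hΦ]
    rw [this]; fun_prop
  have hsymm : ∀ p, Φ.symm (φ p.1, ψ p) = p := fun p => by rw [← hΦ, Φ.symm_apply_apply]
  have hφs : ∀ s' w, φ (Φ.symm (s', w)).1 = s' := fun s' w => by
    have := hΦ (Φ.symm (s', w))
    rw [Φ.apply_symm_apply] at this
    exact (congrArg Prod.fst this).symm
  intro a b hab
  by_contra hne
  have hd : 0 < dist a b := dist_pos.2 hne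
  have : PathConnectedSpace ↥V :=
    isPathConnected_iff_pathConnectedSpace.1 (hVopen.isConnected_iff_isPathConnected.1 hVconn)
  let γ : Path (ψ (a, ⟨v0, hv0⟩)) (ψ (b, ⟨v0, hv0⟩)) := PathConnectedSpace.somePath _ _
  let σ : ℝ → ↥S := fun t => (Φ.symm (φ b, γ.extend ((t + 1) / 2))).1
  have hσc : Continuous σ := by fun_prop
  have hσφ : ∀ t, φ (σ t) = φ b := fun t => hφs _ _
  have hσa : σ (-1) = a := by
    have := hsymm (a, ⟨v0, hv0⟩)
    simp only [hab] at this
    simp [σ, this]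
  have hσb : σ 1 = b := by
    have := hsymm (b, ⟨v0, hv0⟩)
    simp only at this
    simp [σ, this]
  -- a small cube around `v0` inside `V`
  have hcube : ∀ᶠ x : Fin n → ℝ in 𝓝 0, v0 + WithLp.toLp 2 x ∈ V := by
    have hc : Continuous fun x : Fin n → ℝ => v0 + WithLp.toLp 2 x := by fun_prop
    refine hc.continuousAt.eventually_mem (hVopen.mem_nhds ?_)
    simpa using hv0
  obtain ⟨r, hr, hcube⟩ := Metric.nhds_basis_closedBall.eventually_iff.1 hcube
  have hmem : ∀ y : Fin (n+1) → Icc (-1:ℝ) 1,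
      v0 + WithLp.toLp 2 (fun i : Fin n => r * (y i.succ : ℝ)) ∈ V := by
    intro y
    apply hcube
    rw [mem_closedBall_zero_iff, pi_norm_le_iff_of_nonneg hr.le]
    intro i
    have := abs_le.2 (y i.succ).2
    rw [norm_mul, Real.norm_of_nonneg hr.le, Real.norm_eq_abs]
    nlinarith
  let k : (Fin (n+1) → Icc (-1:ℝ) 1) → ↥V := fun y => ψ (σ (y 0), ⟨_, hmem y⟩)
  have hk : Continuous k := by
    apply hψ.comp
    refine Continuous.prodMk (by fun_prop) ?_
    exact Continuous.subtype_mk (by fun_prop) _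
  let G0 : ↥V → (Fin (n+1) → ℝ) := fun w =>
    Fin.cons ((dist (Φ.symm (φ b, w)).1 a - dist (Φ.symm (φ b, w)).1 b) / dist a b)
      (fun i => (((Φ.symm (φ b, w)).2 : EuclideanSpace ℝ (Fin n)) i - v0 i) / r)
  have hG0 : Continuous G0 := by
    apply continuous_pi
    intro i
    refine Fin.cases ?_ (fun j => ?_) i
    · simp only [G0, Fin.cons_zero]; fun_prop
    · simp only [G0, Fin.cons_succ]; fun_prop
  have hkinv : ∀ y, Φ.symm (φ b, k y) = (σ (y 0), ⟨_, hmem y⟩) := by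
    intro y
    have := hsymm (σ (y 0), ⟨_, hmem y⟩)
    simp only [hσφ] at this
    exact this
  have hG00 : ∀ y, G0 (k y) 0 = (dist (σ (y 0)) a - dist (σ (y 0)) b) / dist a b := by
    intro y
    simp only [G0, Fin.cons_zero, hkinv]
  have hG0s : ∀ y i, G0 (k y) (Fin.succ i) = y i.succ := by
    intro y i
    simp only [G0, Fin.cons_succ, hkinv]
    simp [hr.ne']
  -- extend `G0` by Tietze
  let K : Set (EuclideanSpace ℝ (Fin n)) := range fun y => (k y : EuclideanSpace ℝ (Fin n))
  have hK : IsCompact K := isCompact_range (continuous_subtype_val.comp hk)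
  have hKV : K ⊆ V := by rintro _ ⟨y, rfl⟩; exact (k y).2
  obtain ⟨G, hG⟩ := ContinuousMap.exists_restrict_eq hK.isClosed
    (⟨fun w => G0 (inclusion hKV w), hG0.comp (continuous_inclusion hKV)⟩ : C(K, Fin (n+1) → ℝ))
  have hGk : ∀ y, G (k y : EuclideanSpace ℝ (Fin n)) = G0 (k y) := by
    intro y
    exact DFunLike.congr_fun hG ⟨_, mem_range_self y⟩
  let pr : (Fin (n+1) → ℝ) → (Fin (n+1) → Icc (-1:ℝ) 1) :=
    fun x i => projIcc (-1) 1 (by norm_num) (x i)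
  have hpr : Continuous pr := by
    apply continuous_pi
    intro i
    exact continuous_projIcc.comp (continuous_apply i)
  refine no_cube_factor (N := n) (F := EuclideanSpace ℝ (Fin n)) (by simp)
    (fun x => (k (pr x) : EuclideanSpace ℝ (Fin n)))
    (continuous_subtype_val.comp (hk.comp hpr)) K hK (fun x => mem_range_self _) G G.continuous
    ?_ ?_
  · intro x i hx
    have hp : ((pr x i : Icc (-1:ℝ) 1) : ℝ) = 1 := by
      simp only [pr]; rw [projIcc_of_right_le _ hx]
    rw [hGk]
    induction i using Fin.cases with
    | zero => rw [hG00, hp, hσb, dist_self, sub_zero, dist_comm b a, div_self hd.ne']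
    | succ j => rw [hG0s, hp]
  · intro x i hx
    have hp : ((pr x i : Icc (-1:ℝ) 1) : ℝ) = -1 := by
      simp only [pr]; rw [projIcc_of_le_left _ hx]
    rw [hGk]
    induction i using Fin.cases with
    | zero => rw [hG00, hp, hσa, dist_self, zero_sub, neg_div, div_self hd.ne']
    | succ j => rw [hG0s, hp]

end Helpers

/-- If `Φ(s,v) = (φ(s), ψ(s,v))` is a homeomorphism of `S × V` with `V ⊆ ℝ^n` nonempty,
connected and open, then `φ` is a homeomorphism of `S`, each `ψ_s := ψ(s,·)` is a
homeomorphism of `V`, and `Φ⁻¹(s',v') = (φ⁻¹(s'), ψ_{φ⁻¹(s')}⁻¹(v'))`. -/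
theorem components_of_triangular_homeomorph
    {m n : ℕ} (S : Set (EuclideanSpace ℝ (Fin m))) (V : Set (EuclideanSpace ℝ (Fin n)))
    (hVne : V.Nonempty) (hVconn : IsConnected V) (hVopen : IsOpen V)
    (Φ : (↥S × ↥V) ≃ₜ (↥S × ↥V))
    (φ : ↥S → ↥S) (ψ : ↥S × ↥V → ↥V)
    (hΦ : ∀ p : ↥S × ↥V, Φ p = (φ p.1, ψ p)) :
    IsHomeomorph φ ∧
    (∀ s : ↥S, IsHomeomorph (fun v : ↥V => ψ (s, v))) ∧
    (∀ (s' : ↥S) (v' : ↥V),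
      Φ.symm (s', v') =
        (@Function.invFun ↥S ↥S ⟨s'⟩ φ s',
         @Function.invFun ↥V ↥V hVne.to_subtype
           (fun v : ↥V => ψ (@Function.invFun ↥S ↥S ⟨s'⟩ φ s', v)) v')) := by
  have hΦc : Continuous Φ := Φ.continuous
  have hψ : Continuous ψ := by
    have : ψ = fun p => (Φ p).2 := by ext1 p; rw [hΦ]
    rw [this]; fun_prop
  obtain ⟨v0, hv0⟩ := hVne
  have hsymm : ∀ p, Φ.symm (φ p.1, ψ p) = p := fun p => by rw [← hΦ, Φ.symm_apply_apply]
  have hφs : ∀ s' w, φ (Φ.symm (s', w)).1 = s' := fun s' w => by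
    have := hΦ (Φ.symm (s', w))
    rw [Φ.apply_symm_apply] at this
    exact (congrArg Prod.fst this).symm
  have hψs : ∀ s' w, ψ (Φ.symm (s', w)) = w := fun s' w => by
    have := hΦ (Φ.symm (s', w))
    rw [Φ.apply_symm_apply] at this
    exact (congrArg Prod.snd this).symm
  have hinj : Function.Injective φ := triangular_base_injective S V hv0 hVconn hVopen Φ φ ψ hΦ
  have hφ : IsHomeomorph φ := by
    rw [isHomeomorph_iff_exists_inverse]
    refine ⟨?_, fun s' => (Φ.symm (s', ⟨v0, hv0⟩)).1, fun s => hinj (hφs _ _), fun s' => hφs _ _,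
      by fun_prop⟩
    have : φ = fun s => (Φ (s, ⟨v0, hv0⟩)).1 := by ext1 s; rw [hΦ]
    rw [this]; fun_prop
  have hfib : ∀ s w, (Φ.symm (φ s, w)).1 = s := fun s w => hinj (hφs _ _)
  have hψh : ∀ s : ↥S, IsHomeomorph (fun v : ↥V => ψ (s, v)) := by
    intro s
    rw [isHomeomorph_iff_exists_inverse]
    refine ⟨by fun_prop, fun w => (Φ.symm (φ s, w)).2, fun v => ?_, fun w => ?_, by fun_prop⟩
    · change (Φ.symm (φ (s, v).1, ψ (s, v))).2 = v
      rw [hsymm]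
    · have : ((s, (Φ.symm (φ s, w)).2) : ↥S × ↥V) = Φ.symm (φ s, w) :=
        Prod.ext (hfib s w).symm rfl
      change ψ (s, (Φ.symm (φ s, w)).2) = w
      rw [this, hψs]
  refine ⟨hφ, hψh, fun s' v' => ?_⟩
  have e1 : @Function.invFun ↥S ↥S ⟨s'⟩ φ s' = (Φ.symm (s', v')).1 := by
    have : Nonempty ↥S := ⟨s'⟩
    apply hinj
    rw [hφs]
    exact Function.invFun_eq ⟨_, hφs s' v'⟩
  rw [e1]
  refine Prod.ext rfl ?_
  apply (hψh (Φ.symm (s', v')).1).injective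
  have e2 := @Function.invFun_eq ↥V ↥V ⟨⟨v0, hv0⟩⟩ (fun v : ↥V => ψ ((Φ.symm (s', v')).1, v)) v'
    ⟨(Φ.symm (s', v')).2, hψs s' v'⟩
  exact (hψs s' v').trans e2.symm
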